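/- arXiv:2012.03772 — 5 statements merged into one kernel-verified Lean document; each statement's English description precedes it below -/
import Mathlib

section
/- Let Ω ⊂ ℝ^d be an open bounded domain, let the kernel η satisfy (K1)–(K3), and let (s_n) ⊂ (0,∞) be a null sequence. Then for every sequence (u_n) ⊂ L^∞(Ω) converging to u in L^∞(Ω), one has liminf_{n→∞} F_{s_n}(u_n) ≥ σ_η · F(u). -/
open MeasureTheory Filter Set Topology ENNReal

noncomputable section

/-- Euclidean space `ℝ^d`. -/
abbrev Euc (d : ℕ) := EuclideanSpace ℝ (Fin d)

variable {d : ℕ}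

/-- The geodesic distance on `Ω` induced by the Euclidean distance: the infimal length
(`eVariationOn`, i.e. the supremum of sums of distances over partitions) of continuous curves
`γ : [0,1] → ℝ^d` with `γ((0,1)) ⊆ Ω` (so that also endpoints in `∂Ω` can be reached),
`γ 0 = x` and `γ 1 = y`. -/
def geoDist (Ω : Set (Euc d)) (x y : Euc d) : ℝ≥0∞ :=
  ⨅ (γ : ℝ → Euc d) (_ : ContinuousOn γ (Set.Icc 0 1))
    (_ : Set.MapsTo γ (Set.Ioo 0 1) Ω) (_ : γ 0 = x) (_ : γ 1 = y),
    eVariationOn γ (Set.Icc 0 1)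

/-- The geodesic distance function to a set `O`. -/
def dGeo (Ω O : Set (Euc d)) (x : Euc d) : ℝ :=
  (⨅ y ∈ O, geoDist Ω x y).toReal

/-- Condition (D): `lim_{δ↓0} sup { d_Ω(x,y)/|x-y| : x,y ∈ Ω, |x-y| < δ } ≤ 1`. -/
def condD (Ω : Set (Euc d)) : Prop :=
  ∀ ε : ℝ, 0 < ε → ∃ δ : ℝ, 0 < δ ∧ ∀ x ∈ Ω, ∀ y ∈ Ω,
    dist x y < δ → geoDist Ω x y ≤ ENNReal.ofReal ((1 + ε) * dist x y)

/-- The kernel assumptions (K1)–(K3): `η : [0,∞) → [0,∞)` is positive and continuous at `0`,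
non-increasing, and has support contained in `[0,c]`. -/
structure IsKernel (η : ℝ → ℝ) (c : ℝ) : Prop where
  nonneg : ∀ t, 0 ≤ η t
  pos_zero : 0 < η 0
  cont_zero : ContinuousAt η 0
  antitone : AntitoneOn η (Set.Ici 0)
  c_pos : 0 < c
  compact_supp : ∀ t, c < t → η t = 0

/-- `σ_η := esssup_{t ≥ 0} η(t)·t`. -/
def sigmaEta (η : ℝ → ℝ) : ℝ≥0∞ :=
  essSup (fun t => ENNReal.ofReal (η t * t)) (volume.restrict (Set.Ici (0 : ℝ)))

/-- The `L^∞(Ω)` norm of a function. -/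
def einfNorm (Ω : Set (Euc d)) (u : Euc d → ℝ) : ℝ≥0∞ :=
  essSup (fun x => (‖u x‖₊ : ℝ≥0∞)) (volume.restrict Ω)

/-- Convergence in `L^∞(Ω)`. -/
def TendstoLinf (Ω : Set (Euc d)) (un : ℕ → Euc d → ℝ) (u : Euc d → ℝ) : Prop :=
  Filter.Tendsto (fun n => einfNorm Ω (fun x => un n x - u x)) Filter.atTop (nhds 0)

/-- A sequence is relatively compact in `L^∞(Ω)` iff every subsequence has a further
subsequence converging in `L^∞(Ω)`. -/
def SeqRelCompactLinf (Ω : Set (Euc d)) (un : ℕ → Euc d → ℝ) : Prop :=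
  ∀ φ : ℕ → ℕ, StrictMono φ → ∃ ψ : ℕ → ℕ, StrictMono ψ ∧
    ∃ v : Euc d → ℝ, TendstoLinf Ω (fun k => un (φ (ψ k))) v

/-- The non-local functional `F_s(u) = (1/s) esssup_{x,y∈Ω} η(|x-y|/s) |u(x) - u(y)|`. -/
def Fnl (Ω : Set (Euc d)) (η : ℝ → ℝ) (s : ℝ) (u : Euc d → ℝ) : ℝ≥0∞ :=
  ENNReal.ofReal (1 / s) *
    essSup (fun q : Euc d × Euc d => ENNReal.ofReal (η (dist q.1 q.2 / s) * |u q.1 - u q.2|))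
      ((volume.restrict Ω).prod (volume.restrict Ω))

/-- `v` is locally Lipschitz on `Ω`. -/
def LocLipOn (Ω : Set (Euc d)) (v : Euc d → ℝ) : Prop :=
  ∀ x ∈ Ω, ∃ ε : ℝ, 0 < ε ∧ ∃ K : NNReal, LipschitzOnWith K v (Metric.ball x ε ∩ Ω)

/-- `esssup_{x ∈ Ω} |∇v(x)|`. -/
def gradSup (Ω : Set (Euc d)) (v : Euc d → ℝ) : ℝ≥0∞ :=
  essSup (fun x => (‖fderiv ℝ v x‖₊ : ℝ≥0∞)) (volume.restrict Ω)

/-- The continuum functional `F(u) = esssup_{x∈Ω} |∇u(x)|` if `u ∈ W^{1,∞}(Ω)`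
(i.e. `u` has a locally Lipschitz representative on `Ω`, whose a.e. gradient is then taken),
and `F(u) = ∞` otherwise. -/
def Floc (Ω : Set (Euc d)) (u : Euc d → ℝ) : ℝ≥0∞ :=
  ⨅ (v : Euc d → ℝ) (_ : u =ᵐ[volume.restrict Ω] v) (_ : LocLipOn Ω v), gradSup Ω v

/-- The constrained continuum functional: additionally the representative must equal `g` on `O`. -/
def FlocCons (Ω O : Set (Euc d)) (g : Euc d → ℝ) (u : Euc d → ℝ) : ℝ≥0∞ :=
  ⨅ (v : Euc d → ℝ) (_ : u =ᵐ[volume.restrict Ω] v) (_ : LocLipOn Ω v)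
    (_ : Set.EqOn v g O), gradSup Ω v

/-- The discrete functional `E_n(𝐮) = (1/s) max_{x,y ∈ Ω_n} η(|x-y|/s) |𝐮(x) - 𝐮(y)|`. -/
def Edisc (Ωn : Set (Euc d)) (η : ℝ → ℝ) (s : ℝ) (f : Euc d → ℝ) : ℝ≥0∞ :=
  ENNReal.ofReal (1 / s) *
    ⨆ (x : Euc d) (_ : x ∈ Ωn) (y : Euc d) (_ : y ∈ Ωn),
      ENNReal.ofReal (η (dist x y / s) * |f x - f y|)

/-- The constrained discrete functional, extended to `L^∞(Ω)`: its value is `E_n(f)` if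
`u = f ∘ pₙ` (as elements of `L^∞(Ω)`) for a graph function `f` with `f = g` on `Oₙ`,
and `∞` otherwise. -/
def EdiscCons (Ω Ωn On : Set (Euc d)) (pn : Euc d → Euc d) (g : Euc d → ℝ)
    (η : ℝ → ℝ) (s : ℝ) (u : Euc d → ℝ) : ℝ≥0∞ :=
  ⨅ (f : Euc d → ℝ) (_ : u =ᵐ[volume.restrict Ω] fun x => f (pn x))
    (_ : Set.EqOn f g On), Edisc Ωn η s f

/-- `pn` is a closest point projection from `Ω` onto `Ωn`. -/
def IsCPP (Ω Ωn : Set (Euc d)) (pn : Euc d → Euc d) : Prop :=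
  ∀ x ∈ Ω, pn x ∈ Ωn ∧ ∀ y ∈ Ωn, dist x (pn x) ≤ dist x y

/-- The resolution `rₙ = sup_{x ∈ Ω} min_{y ∈ Ωₙ} |x - y|`. -/
def resol (Ω Ωn : Set (Euc d)) : ℝ := ⨆ x ∈ Ω, Metric.infDist x Ωn


/-- A property that holds almost everywhere on an open set `Ω` is satisfied by some point of
every open neighbourhood of a point of `Ω`. -/
theorem exists_mem_of_ae_restrict {d : ℕ} {Ω V : Set (Euc d)} (hΩ : IsOpen Ω) (hV : IsOpen V)
    {P : Euc d → Prop} (hP : ∀ᵐ y ∂(volume.restrict Ω), P y) {z : Euc d} (hzΩ : z ∈ Ω)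
    (hzV : z ∈ V) : ∃ y ∈ V, y ∈ Ω ∧ P y := by
  have hdense : Dense {y | y ∈ Ω → P y} :=
    Measure.dense_of_ae ((ae_restrict_iff' hΩ.measurableSet).1 hP)
  obtain ⟨y, hy, hyP⟩ := hdense.inter_open_nonempty _ (hΩ.inter hV) ⟨z, hzΩ, hzV⟩
  exact ⟨y, hy.2, hy.1, hyP hy.1⟩

/-- A bound on increments at scale `r` propagates along segments inside a convex open subset. -/
theorem abs_sub_le_of_chain {d : ℕ} {Ω B : Set (Euc d)} (hΩ : IsOpen Ω) (hB : IsOpen B)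
    (hBc : Convex ℝ B) (hBΩ : B ⊆ Ω) {w : Euc d → ℝ} {r m : ℝ} (hr : 0 < r)
    {G : Set (Euc d)} (hG : ∀ᵐ y ∂(volume.restrict Ω), y ∈ G)
    (hw : ∀ x ∈ G, ∀ᵐ y ∂(volume.restrict Ω), dist x y ≤ r → |w x - w y| ≤ m)
    (k : ℕ) {x x' : Euc d} (hx : x ∈ G ∩ B) (hx' : x' ∈ G ∩ B)
    (hxx' : dist x x' < (k + 1) * r) : |w x - w x'| ≤ (k + 2) * m := by
  induction k generalizing x with
  | zero =>
    obtain ⟨y, ⟨hy1, hy2⟩, -, hy3, hy4⟩ := exists_mem_of_ae_restrict hΩ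
      (Metric.isOpen_ball.inter Metric.isOpen_ball) ((hw x hx.1).and (hw x' hx'.1))
      (hBΩ hx'.2) (z := x') (V := Metric.ball x r ∩ Metric.ball x' r)
      ⟨by rw [Metric.mem_ball, dist_comm]; simpa using hxx', Metric.mem_ball_self hr⟩
    have h1 := hy3 (by rw [dist_comm]; exact hy1.le)
    have h2 := hy4 (by rw [dist_comm]; exact hy2.le)
    rw [abs_sub_comm] at h2
    have := abs_sub_le (w x) (w y) (w x')
    push_cast
    linarith
  | succ k ih =>
    push_cast at hxx' ⊢
    set θ : ℝ := 1 / (k + 1 + 1) with hθ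
    have hθ0 : 0 < θ := by positivity
    have hθk : θ * (k + 1 + 1) = 1 := by rw [hθ]; field_simp
    have hθ1 : 0 < 1 - θ := by
      have : (0 : ℝ) ≤ k := Nat.cast_nonneg k
      nlinarith
    set z := AffineMap.lineMap x x' θ with hz
    have hzB : z ∈ B := hBc.lineMap_mem hx.2 hx'.2 ⟨hθ0.le, by linarith⟩
    have hz1 : dist z x < r := by
      rw [hz, dist_lineMap_left, Real.norm_of_nonneg hθ0.le]
      nlinarith
    have hz2 : dist z x' < (k + 1) * r := by
      rw [hz, dist_lineMap_right, Real.norm_of_nonneg hθ1.le]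
      have : (1 - θ) * ((k + 1 + 1) * r) = (k + 1) * r := by linear_combination (-r) * hθk
      nlinarith
    obtain ⟨y, ⟨⟨hy1, hy2⟩, hyB⟩, -, hy3, hyG⟩ := exists_mem_of_ae_restrict hΩ
      ((Metric.isOpen_ball.inter Metric.isOpen_ball).inter hB) ((hw x hx.1).and hG)
      (hBΩ hzB) (V := (Metric.ball x r ∩ Metric.ball x' ((k + 1) * r)) ∩ B)
      ⟨⟨hz1, hz2⟩, hzB⟩
    have h1 := hy3 (by rw [dist_comm]; exact hy1.le)
    have h2 := ih ⟨hyG, hyB⟩ hy2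
    have := abs_sub_le (w x) (w y) (w x')
    linarith

/-- A function that is `K`-Lipschitz, on balls inside `Ω`, off a null set has a representative
whose gradient is bounded by `K`. -/
theorem Floc_le_of_lipschitzOn {d : ℕ} {Ω : Set (Euc d)} (hΩ : IsOpen Ω) {u : Euc d → ℝ}
    {G : Set (Euc d)} (hG : ∀ᵐ y ∂(volume.restrict Ω), y ∈ G) {K : NNReal}
    (hu : ∀ x ε, Metric.ball x ε ⊆ Ω → LipschitzOnWith K u (G ∩ Metric.ball x ε)) :
    Floc Ω u ≤ K := by
  have hext : ∀ x ε, Metric.ball x ε ⊆ Ω →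
      ∃ g : Euc d → ℝ, LipschitzWith K g ∧ EqOn u g (G ∩ Metric.ball x ε) ∧
        EqOn (extendFrom G u) g (Metric.ball x ε) := by
    intro x ε hxε
    obtain ⟨g, hg, hug⟩ := (hu x ε hxε).extend_real
    refine ⟨g, hg, hug, fun y hy => extendFrom_eq ?_ ?_⟩
    · refine mem_closure_iff.2 fun V hV hyV => ?_
      obtain ⟨a, haV, -, haG⟩ := exists_mem_of_ae_restrict hΩ hV hG (hxε hy) hyV
      exact ⟨a, haV, haG⟩
    · refine (hg.continuous.continuousAt.tendsto.mono_left nhdsWithin_le_nhds).congr' ?_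
      filter_upwards [self_mem_nhdsWithin,
        mem_nhdsWithin_of_mem_nhds (Metric.isOpen_ball.mem_nhds hy)] with a ha1 ha2
      exact (hug ⟨ha1, ha2⟩).symm
  have hlip : ∀ x ∈ Ω, ∃ ε > 0, LipschitzOnWith K (extendFrom G u) (Metric.ball x ε) := by
    intro x hx
    obtain ⟨ε, hε, hsub⟩ := Metric.isOpen_iff.1 hΩ x hx
    obtain ⟨g, hg, -, hvg⟩ := hext x ε hsub
    refine ⟨ε, hε, fun a ha b hb => ?_⟩
    rw [hvg ha, hvg hb]
    exact hg a b
  refine iInf_le_of_le (extendFrom G u) (iInf_le_of_le ?_ (iInf_le_of_le ?_ ?_))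
  · filter_upwards [hG, ae_restrict_mem hΩ.measurableSet] with x hxG hx
    obtain ⟨ε, hε, hsub⟩ := Metric.isOpen_iff.1 hΩ x hx
    obtain ⟨g, -, hug, hvg⟩ := hext x ε hsub
    have hxb := Metric.mem_ball_self (x := x) hε
    rw [hug ⟨hxG, hxb⟩, hvg hxb]
  · intro x hx
    obtain ⟨ε, hε, h⟩ := hlip x hx
    exact ⟨ε, hε, K, h.mono inter_subset_left⟩
  · refine essSup_le_of_ae_le _ ?_
    filter_upwards [ae_restrict_mem hΩ.measurableSet] with x hx
    obtain ⟨ε, hε, h⟩ := hlip x hx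
    have := norm_fderiv_le_of_lipschitzOn ℝ (Metric.ball_mem_nhds x hε) h
    exact_mod_cast this

/-- `L^∞` convergence implies pointwise convergence almost everywhere. -/
theorem TendstoLinf.ae_tendsto {d : ℕ} {Ω : Set (Euc d)} {un : ℕ → Euc d → ℝ}
    {u : Euc d → ℝ} (h : TendstoLinf Ω un u) :
    ∀ᵐ x ∂(volume.restrict Ω), Tendsto (fun n => un n x) atTop (𝓝 (u x)) := by
  have hae : ∀ᵐ x ∂(volume.restrict Ω), ∀ n,
      (‖un n x - u x‖₊ : ℝ≥0∞) ≤ einfNorm Ω (fun x => un n x - u x) :=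
    ae_all_iff.2 fun n => ENNReal.ae_le_essSup _
  filter_upwards [hae] with x hx
  rw [tendsto_iff_edist_tendsto_0]
  refine tendsto_of_tendsto_of_tendsto_of_le_of_le tendsto_const_nhds h (fun _ => zero_le)
    fun n => ?_
  rw [edist_eq_enorm_sub]
  exact hx n

/-- A bound on the non-local functional controls increments at scale `s * t`. -/
theorem ae_ae_abs_sub_le_of_Fnl_le {d : ℕ} {Ω : Set (Euc d)} {η : ℝ → ℝ} {c : ℝ}
    (hη : IsKernel η c) {s t : ℝ} (hs : 0 < s) (ht : 0 ≤ t) (hηt : 0 < η t)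
    {w : Euc d → ℝ} {L : NNReal} (hL : Fnl Ω η s w ≤ L) :
    ∀ᵐ x ∂(volume.restrict Ω), ∀ᵐ y ∂(volume.restrict Ω),
      dist x y ≤ s * t → |w x - w y| ≤ s * L / η t := by
  refine Measure.ae_ae_of_ae_prod (p := fun q : Euc d × Euc d =>
    dist q.1 q.2 ≤ s * t → |w q.1 - w q.2| ≤ s * L / η t) ?_
  filter_upwards [ENNReal.ae_le_essSup (μ := (volume.restrict Ω).prod (volume.restrict Ω))
    (fun q : Euc d × Euc d => ENNReal.ofReal (η (dist q.1 q.2 / s) * |w q.1 - w q.2|))]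
    with q hq hdist
  have h1 : ENNReal.ofReal (1 / s * (η (dist q.1 q.2 / s) * |w q.1 - w q.2|)) ≤ L := by
    rw [ENNReal.ofReal_mul (by positivity)]
    exact (mul_le_mul_right hq _).trans hL
  rw [ENNReal.ofReal_le_iff_le_toReal coe_ne_top, coe_toReal, one_div,
    inv_mul_le_iff₀ hs] at h1
  have h2 : η t ≤ η (dist q.1 q.2 / s) :=
    hη.antitone (mem_Ici.2 (by positivity)) (mem_Ici.2 ht)
      ((div_le_iff₀ hs).2 (by linarith))
  rw [le_div_iff₀ hηt, mul_comm]
  exact (mul_le_mul_of_nonneg_right h2 (abs_nonneg _)).trans h1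

/-- If infinitely many of the non-local energies are at most `L`, the local energy of the limit is
at most `L / (η t * t)`. -/
theorem Floc_le_of_frequently_Fnl_le {d : ℕ} {Ω : Set (Euc d)} (hΩ : IsOpen Ω) {η : ℝ → ℝ}
    {c : ℝ} (hη : IsKernel η c) {s : ℕ → ℝ} (hs : ∀ n, 0 < s n)
    (hs0 : Tendsto s atTop (𝓝 0)) {u : Euc d → ℝ} {un : ℕ → Euc d → ℝ}
    (hconv : TendstoLinf Ω un u) {t : ℝ} (ht : 0 < t) (hηt : 0 < η t) {L : NNReal}
    (hL : ∃ᶠ n in atTop, Fnl Ω η (s n) (un n) ≤ L) :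
    Floc Ω u ≤ ENNReal.ofReal (L / (η t * t)) := by
  have hinc : ∀ᵐ x ∂(volume.restrict Ω), ∀ n, Fnl Ω η (s n) (un n) ≤ L →
      ∀ᵐ y ∂(volume.restrict Ω),
        dist x y ≤ s n * t → |un n x - un n y| ≤ s n * L / η t := by
    refine ae_all_iff.2 fun n => ?_
    by_cases hn : Fnl Ω η (s n) (un n) ≤ L
    · filter_upwards [ae_ae_abs_sub_le_of_Fnl_le hη (hs n) ht.le hηt hn] with x hx _
      exact hx
    · exact Eventually.of_forall fun x h => absurd h hn
  refine Floc_le_of_lipschitzOn hΩ (hinc.and hconv.ae_tendsto) fun z ε hz => ?_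
  refine LipschitzOnWith.of_dist_le_mul fun x hx y hy => ?_
  rw [Real.coe_toNNReal _ (by positivity), Real.dist_eq]
  have hlim : Tendsto (fun n => L / (η t * t) * dist x y + s n * (2 * L / η t)) atTop
      (𝓝 (L / (η t * t) * dist x y)) := by
    simpa using tendsto_const_nhds.add (hs0.mul_const (2 * (L : ℝ) / η t))
  refine le_of_tendsto_of_tendsto_of_frequently (hx.1.2.sub hy.1.2).abs hlim
    (hL.mono fun n hn => ?_)
  have hst : 0 < s n * t := mul_pos (hs n) ht
  have hk := abs_sub_le_of_chain hΩ Metric.isOpen_ball (convex_ball z ε) hz hst hinc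
    (w := un n) (fun x hx => hx n hn) ⌊dist x y / (s n * t)⌋₊ ⟨hx.1.1, hx.2⟩ ⟨hy.1.1, hy.2⟩
    ((div_lt_iff₀ hst).1 (Nat.lt_floor_add_one _))
  have hfl : (⌊dist x y / (s n * t)⌋₊ : ℝ) ≤ dist x y / (s n * t) :=
    Nat.floor_le (by positivity)
  have hm : 0 ≤ s n * L / η t := div_nonneg (mul_nonneg (hs n).le L.2) hηt.le
  have hsn := (hs n).ne'
  calc |un n x - un n y| ≤ (⌊dist x y / (s n * t)⌋₊ + 2) * (s n * L / η t) := hk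
    _ ≤ (dist x y / (s n * t) + 2) * (s n * L / η t) := by gcongr
    _ = L / (η t * t) * dist x y + s n * (2 * L / η t) := by field_simp

/-- Non-local to local liminf inequality. -/
theorem statement_2 {d : ℕ} (Ω : Set (Euc d)) (hΩo : IsOpen Ω) (hΩc : IsConnected Ω)
    (hΩb : Bornology.IsBounded Ω)
    (η : ℝ → ℝ) (c : ℝ) (hη : IsKernel η c)
    (s : ℕ → ℝ) (hs : ∀ n, 0 < s n) (hs0 : Filter.Tendsto s Filter.atTop (nhds 0))
    (u : Euc d → ℝ) (un : ℕ → Euc d → ℝ)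
    (hu : einfNorm Ω u ≠ ⊤) (hun : ∀ n, einfNorm Ω (un n) ≠ ⊤)
    (hconv : TendstoLinf Ω un u) :
    sigmaEta η * Floc Ω u ≤ Filter.liminf (fun n => Fnl Ω η (s n) (un n)) Filter.atTop := by
  refine ENNReal.mul_le_of_forall_lt fun a ha b hb => ?_
  refine le_of_forall_gt_imp_ge_of_dense fun L' hL' => ?_
  obtain rfl | hL'top := eq_or_ne L' ⊤
  · exact le_top
  lift L' to NNReal using hL'top with L
  obtain ⟨t, hta, ht⟩ := ((frequently_lt_of_lt_limsup (h := ha)).and_eventually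
    (ae_restrict_mem measurableSet_Ici)).exists
  have hpos : 0 < η t * t := ENNReal.ofReal_pos.1 (zero_le.trans_lt hta)
  have ht0 : 0 < t := lt_of_le_of_ne ht (by rintro rfl; simp at hpos)
  have hηt : 0 < η t := pos_of_mul_pos_left hpos ht0.le
  have hF := Floc_le_of_frequently_Fnl_le hΩo hη hs hs0 hconv ht0 hηt
    ((frequently_lt_of_liminf_lt (h := hL')).mono fun _ h => h.le)
  calc a * b ≤ ENNReal.ofReal (η t * t) * ENNReal.ofReal (L / (η t * t)) :=
        mul_le_mul' hta.le (hb.le.trans hF)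
    _ = L := by
        rw [← ENNReal.ofReal_mul hpos.le, mul_div_cancel₀ _ hpos.ne', ENNReal.ofReal_coe_nnreal]

end
end

section
/- Let Ω ⊂ ℝ^d be an open bounded domain satisfying the geodesic condition (D), let the kernel η satisfy (K1)–(K3), and let (s_n) ⊂ (0,∞) be a null sequence. Then for each u ∈ L^∞(Ω) there exists a sequence (u_n) ⊂ L^∞(Ω) converging to u strongly in L^∞(Ω) such that limsup_{n→∞} F_{s_n}(u_n) ≤ σ_η · F(u); in fact the constant sequence u_n := u satisfies this inequality. -/
open MeasureTheory Filter Set Topology ENNReal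

noncomputable section

variable {d : ℕ}

/-- A Lipschitz function whose gradient is almost everywhere bounded by `L` on an open convex set
is `L`-Lipschitz on that set. -/
theorem LipschitzWith.lipschitzOnWith_of_ae_nnnorm_fderiv_le {E : Type*} [NormedAddCommGroup E]
    [NormedSpace ℝ E] [FiniteDimensional ℝ E] [MeasurableSpace E] [BorelSpace E]
    {μ : Measure E} [μ.IsAddHaarMeasure] {w : E → ℝ} {K L : NNReal} {B : Set E}
    (hw : LipschitzWith K w) (hB : IsOpen B) (hconv : Convex ℝ B)
    (hL : ∀ᵐ x ∂μ, x ∈ B → ‖fderiv ℝ w x‖₊ ≤ L) : LipschitzOnWith L w B := by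
  have key (h : E) : ∀ᵐ x ∂μ, x ∈ B → x + h ∈ B → |w (x + h) - w x| ≤ L * ‖h‖ := by
    obtain ⟨S, hS, hSm, hSμ⟩ :=
      (hw.ae_differentiableAt (μ := μ)).and hL |>.exists_measurable_mem
    have hline := (ae_ae_add_linearMap_mem_iff (LinearMap.toSpanSingleton ℝ E h) volume μ hSm).2 hS
    filter_upwards [hline] with x hx hxB hxhB
    set g : ℝ → ℝ := fun t => w (x + t • h) with hg
    have hgLip : LipschitzWith (K * ‖h‖₊) g := by
      refine LipschitzWith.of_dist_le_mul fun t r => (hw.dist_le_mul _ _).trans_eq ?_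
      simp [dist_eq_norm, ← sub_smul, norm_smul]
      ring
    have hftc := (hgLip.lipschitzOnWith (s := uIcc 0 1)).absolutelyContinuousOnInterval
      |>.integral_deriv_eq_sub
    have hbound : ‖∫ t in (0 : ℝ)..1, deriv g t‖ ≤ (L * ‖h‖) * |(1 : ℝ) - 0| := by
      refine intervalIntegral.norm_integral_le_of_norm_le_const_ae ?_
      filter_upwards [hx] with t ht ht01
      rw [uIoc_of_le zero_le_one] at ht01
      have hmem : x + t • h ∈ B := by
        simpa using hconv.add_smul_mem hxB hxhB ⟨ht01.1.le, ht01.2⟩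
      obtain ⟨hd, hle⟩ := hSμ _ ht
      have hd' : HasDerivAt g (fderiv ℝ w (x + t • h) h) t := by
        have hline' : HasDerivAt (fun r : ℝ => x + r • h) h t := by
          simpa using ((hasDerivAt_id t).smul_const h).const_add x
        exact hd.hasFDerivAt.comp_hasDerivAt t hline'
      rw [hd'.deriv]
      exact (ContinuousLinearMap.le_opNorm _ _).trans
        (mul_le_mul_of_nonneg_right (hle hmem) (norm_nonneg _))
    rw [hftc] at hbound
    simpa [hg] using hbound
  refine LipschitzOnWith.of_dist_le_mul fun x hx y hy => ?_
  by_contra! hlt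
  set h := x - y with hh
  have hopen : IsOpen {z | z ∈ B ∧ z + h ∈ B ∧ L * ‖h‖ < |w (z + h) - w z|} := by
    have hc := hw.continuous
    exact hB.inter ((hB.preimage (by fun_prop : Continuous fun z => z + h)).inter
      (isOpen_lt (f := fun _ => L * ‖h‖) (g := fun z => |w (z + h) - w z|)
        (by fun_prop) (by fun_prop)))
  refine (hopen.measure_pos μ ⟨y, hy, by simpa [hh] using hx, ?_⟩).ne' ?_
  · simpa [hh, Real.dist_eq, dist_eq_norm] using hlt
  · refine measure_mono_null ?_ (key h)
    rintro z ⟨h1, h2, h3⟩ h4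
    exact absurd (h4 h1 h2) (not_le.2 h3)

/-- A function which is Lipschitz on an open convex subset of `Ω`, and whose gradient is
essentially bounded by `L` on `Ω`, is `L`-Lipschitz on that subset. -/
theorem LipschitzOnWith.of_ae_nnnorm_fderiv_le {Ω : Set (Euc d)} {v : Euc d → ℝ} {K L : NNReal}
    {B : Set (Euc d)} (hv : LipschitzOnWith K v B) (hΩ : MeasurableSet Ω) (hB : IsOpen B)
    (hconv : Convex ℝ B) (hBΩ : B ⊆ Ω)
    (hL : ∀ᵐ x ∂volume.restrict Ω, ‖fderiv ℝ v x‖₊ ≤ L) : LipschitzOnWith L v B := by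
  obtain ⟨w, hw, hvw⟩ := hv.extend_real
  rw [ae_restrict_iff' hΩ] at hL
  have hwB : LipschitzOnWith L w B := by
    refine hw.lipschitzOnWith_of_ae_nnnorm_fderiv_le (μ := volume) hB hconv ?_
    filter_upwards [hL] with x hx hxB
    rw [← (hvw.eventuallyEq_of_mem (hB.mem_nhds hxB)).fderiv_eq]
    exact hx (hBΩ hxB)
  intro x hx y hy
  rw [hvw hx, hvw hy]
  exact hwB hx hy

/-- Along a curve, a function which is `L`-Lipschitz near each point varies by at most `L` times
the length of the curve. -/
theorem edist_le_mul_eVariationOn {X Y : Type*} [PseudoEMetricSpace X] [PseudoEMetricSpace Y]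
    {A : Set X} {v : X → Y} {L : NNReal}
    (hloc : ∀ x ∈ A, ∃ U, IsOpen U ∧ x ∈ U ∧ LipschitzOnWith L v U)
    {γ : ℝ → X} (hγ : ContinuousOn γ (Icc 0 1)) (hmaps : MapsTo γ (Icc 0 1) A) :
    edist (v (γ 0)) (v (γ 1)) ≤ L * eVariationOn γ (Icc 0 1) := by
  choose! U hUo hmem hUL using hloc
  obtain ⟨t, ht0, htm, ⟨m, hm⟩, hcov⟩ := exists_monotone_Icc_subset_open_cover_Icc
    (zero_le_one (α := ℝ)) (c := fun x : A => (Icc (0 : ℝ) 1).domRestrict γ ⁻¹' U x)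
    (fun x => (hUo x x.2).preimage hγ.domRestrict)
    (fun r _ => mem_iUnion.2 ⟨⟨γ r, hmaps r.2⟩, hmem _ (hmaps r.2)⟩)
  calc edist (v (γ 0)) (v (γ 1)) = edist (v (γ (t 0))) (v (γ (t m))) := by
        rw [ht0, hm m le_rfl]
    _ ≤ ∑ n ∈ Finset.range m, edist (v (γ (t n))) (v (γ (t (n + 1)))) :=
        edist_le_range_sum_edist (fun n => v (γ (t n))) m
    _ ≤ ∑ n ∈ Finset.range m, L * edist (γ (t (n + 1))) (γ (t n)) := by
        refine Finset.sum_le_sum fun n _ => ?_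
        obtain ⟨x, hx⟩ := hcov n
        rw [edist_comm (γ (t (n + 1)))]
        exact hUL x x.2 (hx ⟨le_rfl, htm n.le_succ⟩) (hx ⟨htm n.le_succ, le_rfl⟩)
    _ = L * ∑ n ∈ Finset.range m, edist (γ (t (n + 1))) (γ (t n)) := by rw [Finset.mul_sum]
    _ ≤ L * eVariationOn γ (Icc 0 1) := by
        gcongr
        exact eVariationOn.sum_le (u := fun n => (t n : ℝ)) (fun _ _ h => htm h) fun n => (t n).2

/-- A function which is locally `L`-Lipschitz on an open set is `L`-Lipschitz with respect to
the geodesic distance. -/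
theorem edist_le_mul_geoDist {Ω : Set (Euc d)} {v : Euc d → ℝ} {L : NNReal}
    (hloc : ∀ x ∈ Ω, ∃ U, IsOpen U ∧ x ∈ U ∧ LipschitzOnWith L v U)
    {x y : Euc d} (hx : x ∈ Ω) (hy : y ∈ Ω) (hxy : geoDist Ω x y ≠ ⊤) :
    edist (v x) (v y) ≤ L * geoDist Ω x y := by
  have hcurve : ∀ γ : ℝ → Euc d, ContinuousOn γ (Icc 0 1) → MapsTo γ (Ioo 0 1) Ω → γ 0 = x →
      γ 1 = y → edist (v x) (v y) ≤ L * eVariationOn γ (Icc 0 1) := by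
    rintro γ hγ hmaps rfl rfl
    refine edist_le_mul_eVariationOn hloc hγ fun r hr => ?_
    rcases eq_endpoints_or_mem_Ioo_of_mem_Icc hr with rfl | rfl | hr
    exacts [hx, hy, hmaps hr]
  rcases eq_or_ne L 0 with rfl | hL
  · simp only [geoDist, ← lt_top_iff_ne_top, iInf_lt_iff] at hxy
    obtain ⟨γ, hγ, hmaps, h0, h1, -⟩ := hxy
    simpa using hcurve γ hγ hmaps h0 h1
  · simp only [geoDist, ENNReal.mul_iInf_of_ne (ENNReal.coe_ne_zero.2 hL) ENNReal.coe_ne_top]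
    exact le_iInf fun γ => le_iInf₂ fun hγ hmaps => le_iInf₂ fun h0 h1 => hcurve γ hγ hmaps h0 h1

/-- For a non-increasing kernel the essential supremum bounds `η(t) t` pointwise. -/
theorem IsKernel.ofReal_mul_le_sigmaEta {η : ℝ → ℝ} {c : ℝ} (hη : IsKernel η c) {r : ℝ}
    (hr : 0 ≤ r) : ENNReal.ofReal (η r * r) ≤ sigmaEta η := by
  rcases hr.eq_or_lt with rfl | hr
  · simp
  have hae : ∀ᵐ t : ℝ, t ∈ Ici (0 : ℝ) → ENNReal.ofReal (η t * t) ≤ sigmaEta η := by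
    rw [← ae_restrict_iff' measurableSet_Ici]
    exact ENNReal.ae_le_essSup _
  have hsub := (Measure.dense_of_ae hae).open_subset_closure_inter (isOpen_Ioo (a := 0) (b := r))
  have hrmem : r ∈ closure (Ioo 0 r) := by
    rw [closure_Ioo hr.ne]
    exact right_mem_Icc.2 hr.le
  have hclosed : IsClosed {t : ℝ | ENNReal.ofReal (η r * t) ≤ sigmaEta η} :=
    isClosed_le (ENNReal.continuous_ofReal.comp (by fun_prop)) continuous_const
  refine closure_minimal ?_ hclosed (closure_minimal hsub isClosed_closure hrmem)
  rintro t ⟨⟨ht0, htr⟩, ht⟩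
  refine le_trans (ENNReal.ofReal_le_ofReal ?_) (ht ht0.le)
  exact mul_le_mul_of_nonneg_right (hη.antitone ht0.le hr.le htr.le) ht0.le

theorem IsKernel.sigmaEta_ne_zero {η : ℝ → ℝ} {c : ℝ} (hη : IsKernel η c) : sigmaEta η ≠ 0 := by
  obtain ⟨r, hr, hr0⟩ := ((hη.cont_zero.tendsto.eventually_const_lt hη.pos_zero).filter_mono
    nhdsWithin_le_nhds |>.and (self_mem_nhdsWithin (s := Ioi (0 : ℝ)))).exists
  refine (lt_of_lt_of_le ?_ (hη.ofReal_mul_le_sigmaEta (le_of_lt hr0))).ne'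
  exact ENNReal.ofReal_pos.2 (mul_pos hr hr0)

theorem IsKernel.sigmaEta_ne_top {η : ℝ → ℝ} {c : ℝ} (hη : IsKernel η c) : sigmaEta η ≠ ⊤ := by
  refine ((essSup_le_of_ae_le (ENNReal.ofReal (η 0 * c)) ?_).trans_lt ENNReal.ofReal_lt_top).ne
  refine (ae_restrict_iff' measurableSet_Ici).2 (Eventually.of_forall fun t (ht : 0 ≤ t) => ?_)
  refine ENNReal.ofReal_le_ofReal ?_
  rcases le_or_gt t c with htc | htc
  · exact mul_le_mul (hη.antitone self_mem_Ici ht ht) htc ht hη.pos_zero.le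
  · simpa [hη.compact_supp t htc] using mul_nonneg hη.pos_zero.le hη.c_pos.le

/-- If `v` is `L`-Lipschitz up to the factor `1 + ε` at distances below `δ > c s`, then
`F_s(v) ≤ (1 + ε) σ_η L`. -/
theorem Fnl_le_of_edist_le {Ω : Set (Euc d)} (hΩ : MeasurableSet Ω) {η : ℝ → ℝ} {c : ℝ}
    (hη : IsKernel η c) {u v : Euc d → ℝ} (huv : u =ᵐ[volume.restrict Ω] v) {L : NNReal}
    {ε δ s : ℝ} (hε : 0 ≤ ε) (hs : 0 < s) (hsδ : c * s < δ)
    (hv : ∀ x ∈ Ω, ∀ y ∈ Ω, dist x y < δ →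
      edist (v x) (v y) ≤ L * ENNReal.ofReal ((1 + ε) * dist x y)) :
    Fnl Ω η s u ≤ ENNReal.ofReal (1 + ε) * (sigmaEta η * L) := by
  rw [Fnl, ← ENNReal.essSup_const_mul]
  refine essSup_le_of_ae_le _ ?_
  have hgood : ∀ᵐ x ∂volume.restrict Ω, x ∈ Ω ∧ u x = v x := (ae_restrict_mem hΩ).and huv
  filter_upwards [Measure.quasiMeasurePreserving_fst.ae hgood,
    Measure.quasiMeasurePreserving_snd.ae hgood]
  rintro ⟨x, y⟩ ⟨hx, hux⟩ ⟨hy, huy⟩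
  simp only [] at hx hux hy huy ⊢
  rw [hux, huy]
  set r := dist x y / s with hr
  have hr0 : 0 ≤ r := by positivity
  rcases lt_or_ge c r with hcr | hcr
  · simp [hη.compact_supp r hcr]
  have hdist : dist x y = r * s := by rw [hr]; field_simp
  have hxyδ : dist x y < δ := by
    rw [hdist]
    exact (mul_le_mul_of_nonneg_right hcr hs.le).trans_lt hsδ
  have hedist : ENNReal.ofReal |v x - v y| ≤ L * ENNReal.ofReal ((1 + ε) * dist x y) := by
    simpa [edist_dist, Real.dist_eq] using hv x hx y hy hxyδ
  calc ENNReal.ofReal (1 / s) * ENNReal.ofReal (η r * |v x - v y|)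
      = ENNReal.ofReal (1 / s) * (ENNReal.ofReal (η r) * ENNReal.ofReal |v x - v y|) := by
        rw [ENNReal.ofReal_mul (hη.nonneg r)]
    _ ≤ ENNReal.ofReal (1 / s) *
          (ENNReal.ofReal (η r) * (L * ENNReal.ofReal ((1 + ε) * dist x y))) := by gcongr
    _ = ENNReal.ofReal (1 + ε) * (ENNReal.ofReal (η r * r) * L) := by
        rw [← ENNReal.ofReal_coe_nnreal, ← ENNReal.ofReal_mul (by positivity),
          ← ENNReal.ofReal_mul (hη.nonneg r), ← ENNReal.ofReal_mul (by positivity),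
          ← ENNReal.ofReal_mul (mul_nonneg (hη.nonneg r) hr0),
          ← ENNReal.ofReal_mul (by positivity), hdist]
        congr 1
        field_simp
    _ ≤ ENNReal.ofReal (1 + ε) * (sigmaEta η * L) := by
        gcongr
        exact hη.ofReal_mul_le_sigmaEta hr0

/-- The limsup inequality for a fixed function and a fixed locally Lipschitz representative. -/
theorem limsup_Fnl_le_mul_gradSup {Ω : Set (Euc d)} (hΩ : IsOpen Ω) (hD : condD Ω) {η : ℝ → ℝ}
    {c : ℝ} (hη : IsKernel η c) {s : ℕ → ℝ} (hs : ∀ n, 0 < s n) (hs0 : Tendsto s atTop (𝓝 0))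
    {u v : Euc d → ℝ} (huv : u =ᵐ[volume.restrict Ω] v) (hv : LocLipOn Ω v) :
    limsup (fun n => Fnl Ω η (s n) u) atTop ≤ sigmaEta η * gradSup Ω v := by
  rcases eq_or_ne (gradSup Ω v) ⊤ with htop | htop
  · simp [htop, ENNReal.mul_top hη.sigmaEta_ne_zero]
  lift gradSup Ω v to NNReal using htop with L hL
  have hgrad : ∀ᵐ x ∂volume.restrict Ω, ‖fderiv ℝ v x‖₊ ≤ L := by
    filter_upwards [ENNReal.ae_le_essSup (μ := volume.restrict Ω)
      fun x => (‖fderiv ℝ v x‖₊ : ℝ≥0∞)] with x hx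
    exact ENNReal.coe_le_coe.1 (hx.trans_eq hL.symm)
  have hloc : ∀ x ∈ Ω, ∃ U, IsOpen U ∧ x ∈ U ∧ LipschitzOnWith L v U := by
    intro x hx
    obtain ⟨ε, hε, K, hK⟩ := hv x hx
    obtain ⟨ρ, hρ, hball⟩ := Metric.mem_nhds_iff.1 (hΩ.mem_nhds hx)
    have hsub : Metric.ball x (min ε ρ) ⊆ Ω :=
      (Metric.ball_subset_ball (min_le_right _ _)).trans hball
    refine ⟨Metric.ball x (min ε ρ), Metric.isOpen_ball,
      Metric.mem_ball_self (lt_min hε hρ), ?_⟩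
    exact (hK.mono (subset_inter (Metric.ball_subset_ball (min_le_left _ _))
      hsub)).of_ae_nnnorm_fderiv_le hΩ.measurableSet Metric.isOpen_ball (convex_ball _ _) hsub hgrad
  have hbound : ∀ ε : ℝ, 0 < ε → limsup (fun n => Fnl Ω η (s n) u) atTop ≤
      ENNReal.ofReal (1 + ε) * (sigmaEta η * L) := by
    intro ε hε
    obtain ⟨δ, hδ, hgeo⟩ := hD ε hε
    have hcs : ∀ᶠ n in atTop, c * s n < δ := by
      have := hs0.const_mul c
      rw [mul_zero] at this
      exact this.eventually_lt_const hδ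
    refine limsup_le_of_le (by isBoundedDefault) ?_
    filter_upwards [hcs] with n hn
    refine Fnl_le_of_edist_le hΩ.measurableSet hη huv hε.le (hs n) hn fun x hx y hy hxy => ?_
    have hle := hgeo x hx y hy hxy
    exact (edist_le_mul_geoDist hloc hx hy (hle.trans_lt ENNReal.ofReal_lt_top).ne).trans
      (mul_le_mul_right hle _)
  have hlim : Tendsto (fun ε : ℝ => ENNReal.ofReal (1 + ε) * (sigmaEta η * L)) (𝓝[>] 0)
      (𝓝 (ENNReal.ofReal (1 + 0) * (sigmaEta η * L))) := by
    refine ENNReal.Tendsto.mul_const (Tendsto.mono_left ?_ nhdsWithin_le_nhds) (Or.inl (by simp))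
    exact (ENNReal.continuous_ofReal.comp (continuous_const_add (1 : ℝ))).tendsto 0
  rw [add_zero, ENNReal.ofReal_one, one_mul] at hlim
  exact ge_of_tendsto hlim (eventually_mem_nhdsWithin.mono fun ε hε => hbound ε hε)

/-- Non-local to local limsup inequality; in fact the constant sequence is a recovery sequence. -/
theorem statement_3 {d : ℕ} (Ω : Set (Euc d)) (hΩo : IsOpen Ω) (hΩc : IsConnected Ω)
    (hΩb : Bornology.IsBounded Ω) (hD : condD Ω)
    (η : ℝ → ℝ) (c : ℝ) (hη : IsKernel η c)
    (s : ℕ → ℝ) (hs : ∀ n, 0 < s n) (hs0 : Filter.Tendsto s Filter.atTop (nhds 0))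
    (u : Euc d → ℝ) (hu : einfNorm Ω u ≠ ⊤) :
    (∃ un : ℕ → Euc d → ℝ, TendstoLinf Ω un u ∧
      Filter.limsup (fun n => Fnl Ω η (s n) (un n)) Filter.atTop ≤ sigmaEta η * Floc Ω u) ∧
    Filter.limsup (fun n => Fnl Ω η (s n) u) Filter.atTop ≤ sigmaEta η * Floc Ω u := by
  have hlimsup : limsup (fun n => Fnl Ω η (s n) u) atTop ≤ sigmaEta η * Floc Ω u := by
    simp only [Floc, ENNReal.mul_iInf_of_ne hη.sigmaEta_ne_zero hη.sigmaEta_ne_top]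
    exact le_iInf fun v => le_iInf₂ fun huv hv =>
      limsup_Fnl_le_mul_gradSup hΩo hD hη hs hs0 huv hv
  refine ⟨⟨fun _ => u, ?_, hlimsup⟩, hlimsup⟩
  simp only [TendstoLinf, einfNorm, sub_self, nnnorm_zero, ENNReal.coe_zero]
  exact tendsto_const_nhds.congr fun _ => essSup_const_bot.symm


end
end

section
/- Let (Ω, μ) be a finite measure space and K ⊂ L^∞(Ω; μ) a set bounded in the L^∞(Ω; μ) norm such that for every ε > 0 there exists a finite partition {V_1,…,V_n} of Ω into subsets of positive finite measure with μ-esssup_{x,y∈V_i} |u(x) − u(y)| < ε for all u ∈ K and all i = 1,…,n. Then K is relatively compact in L^∞(Ω; μ). -/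
open MeasureTheory Filter Set Topology ENNReal

noncomputable section

variable {d : ℕ}

/-- An `ε`-bound on the essential oscillation of `u` over a set `V` of positive measure makes `u`
almost everywhere `ε`-close on `V` to a constant, which may be chosen with the bound of `u`. -/
lemma exists_const_ae_abs_sub_lt {α : Type*} [MeasurableSpace α] {μ : Measure α} [SFinite μ]
    {u : α → ℝ} {V : Set α} (hV : μ V ≠ 0) {C ε : ℝ} (hu : ∀ᵐ x ∂μ, |u x| ≤ C)
    (hosc : essSup (fun q : α × α => ENNReal.ofReal |u q.1 - u q.2|)
      ((μ.restrict V).prod (μ.restrict V)) < ENNReal.ofReal ε) :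
    ∃ c : ℝ, |c| ≤ C ∧ ∀ᵐ y ∂μ.restrict V, |u y - c| < ε := by
  have : NeBot (ae (μ.restrict V)) := ae_neBot.2 (by rwa [Ne, Measure.restrict_eq_zero])
  obtain ⟨x, hx, hxC⟩ := ((Measure.ae_ae_of_ae_prod (ae_lt_of_essSup_lt hosc)).and
    (ae_restrict_of_ae hu)).exists
  refine ⟨u x, hxC, hx.mono fun y hy => ?_⟩
  rw [abs_sub_comm]
  exact (ENNReal.ofReal_lt_ofReal_iff_of_nonneg (abs_nonneg _)).1 hy

lemma ae_abs_coeFn_le_norm {α : Type*} [MeasurableSpace α] {μ : Measure α} (u : Lp ℝ ⊤ μ) :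
    ∀ᵐ x ∂μ, |u x| ≤ ‖u‖ := by
  filter_upwards [enorm_ae_le_eLpNormEssSup u μ] with x hx
  rw [← eLpNorm_exponent_top] at hx
  have h := ENNReal.toReal_mono (Lp.eLpNorm_ne_top u) hx
  rwa [toReal_enorm, Real.norm_eq_abs, ← Lp.norm_def] at h

lemma norm_le_of_ae_abs_le {α : Type*} [MeasurableSpace α] {μ : Measure α} [IsFiniteMeasure μ]
    {u : Lp ℝ ⊤ μ} {C : ℝ} (hC : 0 ≤ C) (hu : ∀ᵐ x ∂μ, |u x| ≤ C) : ‖u‖ ≤ C := by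
  simpa using Lp.norm_le_of_ae_bound (f := u) hC (by simpa only [Real.norm_eq_abs] using hu)

/-- If `f '' K` is totally bounded and `δ`-close values of `f` on `K` have `ε`-close arguments, then
finitely many `ε`-balls cover `K`. -/
lemma exists_finite_cover_balls_of_totallyBounded_image {X Y : Type*} [PseudoMetricSpace X]
    [PseudoMetricSpace Y] {K : Set X} {f : X → Y} {δ ε : ℝ} (hδ : 0 < δ)
    (hf : TotallyBounded (f '' K))
    (hfK : ∀ u ∈ K, ∀ v ∈ K, dist (f u) (f v) < δ → dist u v < ε) :
    ∃ t : Set X, t.Finite ∧ K ⊆ ⋃ y ∈ t, Metric.ball y ε := by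
  obtain ⟨t, htK, ht, hcov⟩ := Metric.finite_approx_of_totallyBounded hf δ hδ
  obtain ⟨s, hsK, hs, rfl⟩ := Set.exists_subset_image_finite_and.1 ⟨t, htK, ht, rfl⟩
  refine ⟨s, hs, fun u hu => ?_⟩
  obtain ⟨_, ⟨v, hv, rfl⟩, huv⟩ := Set.mem_iUnion₂.1 (hcov (Set.mem_image_of_mem f hu))
  exact Set.mem_iUnion₂.2 ⟨v, hv, hfK u hu v (hsK hv) huv⟩

/-- Compactness criterion in `L^∞(Ω; μ)`: a bounded set admitting, for every `ε > 0`, a finite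
partition into sets of positive finite measure on which all oscillations are less than `ε`,
is relatively compact. -/
theorem statement_10 {α : Type*} [MeasurableSpace α] (μ : Measure α) [IsFiniteMeasure μ]
    (K : Set (Lp ℝ ⊤ μ))
    (hbd : ∃ C : ℝ, ∀ u ∈ K, ‖u‖ ≤ C)
    (hpart : ∀ ε : ℝ, 0 < ε → ∃ (n : ℕ) (V : Fin n → Set α),
      (∀ i, MeasurableSet (V i)) ∧
      (Pairwise fun i j => Disjoint (V i) (V j)) ∧
      (⋃ i, V i) = Set.univ ∧
      (∀ i, 0 < μ (V i) ∧ μ (V i) < ⊤) ∧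
      (∀ u ∈ K, ∀ i,
        essSup (fun q : α × α => ENNReal.ofReal |(↑↑u : α → ℝ) q.1 - (↑↑u : α → ℝ) q.2|)
          ((μ.restrict (V i)).prod (μ.restrict (V i))) < ENNReal.ofReal ε)) :
    IsCompact (closure K) := by
  obtain ⟨C, hC⟩ := hbd
  refine TotallyBounded.isCompact_of_isClosed
    (Metric.totallyBounded_iff.2 fun ε hε => ?_).closure isClosed_closure
  obtain ⟨n, V, -, -, hcover, hpos, hosc⟩ := hpart (ε / 4) (by positivity)
  have hconst (u : Lp ℝ ⊤ μ) (i : Fin n) : ∃ c : ℝ, u ∈ K →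
      |c| ≤ C ∧ ∀ᵐ y ∂μ.restrict (V i), |u y - c| < ε / 4 := by
    by_cases hu : u ∈ K
    · obtain ⟨c, hc⟩ := exists_const_ae_abs_sub_lt (hpos i).1.ne'
        ((ae_abs_coeFn_le_norm u).mono fun _ hx => hx.trans (hC u hu)) (hosc u hu i)
      exact ⟨c, fun _ => hc⟩
    · exact ⟨0, fun h => absurd h hu⟩
  choose f hf using hconst
  refine exists_finite_cover_balls_of_totallyBounded_image (f := f) (δ := ε / 4) (by positivity)
    ?_ fun u hu v hv huv => ?_
  · refine (isCompact_univ_pi fun _ => isCompact_Icc).totallyBounded.subset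
      (s₂ := Set.univ.pi fun _ => Set.Icc (-C) C) ?_
    rintro _ ⟨u, hu, rfl⟩ i -
    exact abs_le.1 (hf u i hu).1
  · have hae : ∀ᵐ x ∂μ, |(u - v : Lp ℝ ⊤ μ) x| ≤ 3 * (ε / 4) := by
      suffices h : ∀ i, ∀ᵐ x ∂μ.restrict (V i), |(u - v : Lp ℝ ⊤ μ) x| ≤ 3 * (ε / 4) by
        have h' := (ae_restrict_iUnion_iff V _).2 h
        rwa [hcover, Measure.restrict_univ] at h'
      intro i
      filter_upwards [(hf u i hu).2, (hf v i hv).2, ae_restrict_of_ae (Lp.coeFn_sub u v)]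
        with x hux hvx hsub
      have hi : |f u i - f v i| < ε / 4 := (dist_le_pi_dist (f u) (f v) i).trans_lt huv
      rw [hsub, Pi.sub_apply]
      rw [abs_lt] at hux hvx hi
      rw [abs_le]
      constructor <;> linarith
    rw [dist_eq_norm]
    exact (norm_le_of_ae_abs_le (by positivity) hae).trans_lt (by linarith)


end
end

section
/- If an open bounded domain Ω ⊂ ℝ^d satisfies the geodesic condition (D), then its geodesic diameter is finite: diam_g(Ω) := sup_{x,y∈Ω} d_Ω(x,y) < ∞. -/
open MeasureTheory Filter Set Topology ENNReal

noncomputable section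

variable {d : ℕ}

/-- Triangle inequality for the geodesic distance through a point of the domain. -/
theorem geoDist_triangle {Ω : Set (Euc d)} {x y z : Euc d} (hy : y ∈ Ω) :
    geoDist Ω x z ≤ geoDist Ω x y + geoDist Ω y z := by
  simp only [geoDist, ENNReal.iInf_add, ENNReal.add_iInf, le_iInf_iff]
  intro γ₂ hc₂ hm₂ h0₂ h1₂ γ₁ hc₁ hm₁ h0₁ h1₁
  set γ : ℝ → Euc d := fun t => if t ≤ 1 / 2 then γ₁ (2 * t) else γ₂ (2 * t - 1) with hγ
  have heq₁ : EqOn γ (γ₁ ∘ fun t => 2 * t) (Icc 0 (1 / 2)) := fun t ht => by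
    simp only [hγ, Function.comp, if_pos ht.2]
  have heq₂ : EqOn γ (γ₂ ∘ fun t => 2 * t - 1) (Icc (1 / 2) 1) := fun t ht => by
    rcases ht.1.eq_or_lt with rfl | h
    · simp [hγ, h1₁, h0₂]
    · simp only [hγ, Function.comp, if_neg h.not_ge]
  have hmaps₁ : MapsTo (fun t : ℝ => 2 * t) (Icc 0 (1 / 2)) (Icc 0 1) := fun t ht =>
    ⟨by linarith [ht.1], by linarith [ht.2]⟩
  have hmaps₂ : MapsTo (fun t : ℝ => 2 * t - 1) (Icc (1 / 2) 1) (Icc 0 1) := fun t ht =>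
    ⟨by linarith [ht.1], by linarith [ht.2]⟩
  have hcont : ContinuousOn γ (Icc 0 1) := by
    rw [← Icc_union_Icc_eq_Icc (show (0 : ℝ) ≤ 1 / 2 by norm_num) (by norm_num)]
    exact ((hc₁.comp (by fun_prop) hmaps₁).congr heq₁).union_of_isClosed
      ((hc₂.comp (by fun_prop) hmaps₂).congr heq₂) isClosed_Icc isClosed_Icc
  have hmem : MapsTo γ (Ioo 0 1) Ω := fun t ht => by
    rcases lt_trichotomy t (1 / 2) with h | rfl | h
    · simp only [hγ, if_pos h.le]
      exact hm₁ ⟨by linarith [ht.1], by linarith⟩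
    · simpa [hγ, h1₁] using hy
    · simp only [hγ, if_neg h.not_ge]
      exact hm₂ ⟨by linarith, by linarith [ht.2]⟩
  have h0 : γ 0 = x := by simp [hγ, h0₁]
  have h1 : γ 1 = z := by norm_num [hγ, h1₂]
  refine (iInf₂_le_of_le γ hcont <| iInf₂_le_of_le hmem h0 <| iInf_le _ h1).trans ?_
  have hvar := eVariationOn.Icc_add_Icc γ (s := univ) (a := 0) (b := 1 / 2) (c := 1)
    (by norm_num) (by norm_num) (mem_univ _)
  simp only [univ_inter] at hvar
  rw [← hvar, eVariationOn.congr heq₁, eVariationOn.congr heq₂]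
  exact add_le_add
    (eVariationOn.comp_le_of_monotoneOn _ _ (fun _ _ _ _ _ => by linarith) hmaps₁)
    (eVariationOn.comp_le_of_monotoneOn _ _ (fun _ _ _ _ _ => by linarith) hmaps₂)

/-- In a connected open set satisfying condition (D), the geodesic distance is finite. -/
theorem geoDist_ne_top {Ω : Set (Euc d)} (hΩc : IsConnected Ω) (hD : condD Ω)
    {x y : Euc d} (hx : x ∈ Ω) (hy : y ∈ Ω) : geoDist Ω x y ≠ ⊤ := by
  obtain ⟨δ, hδ, h⟩ := hD 1 one_pos
  refine hΩc.isPreconnected.induction₂' (fun x y => geoDist Ω x y ≠ ⊤) ?_ ?_ hx hy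
  · intro u hu
    filter_upwards [self_mem_nhdsWithin, mem_nhdsWithin_of_mem_nhds (Metric.ball_mem_nhds u hδ)]
      with v hv huv
    exact ⟨ne_top_of_le_ne_top ofReal_ne_top (h u hu v hv (Metric.mem_ball'.1 huv)),
      ne_top_of_le_ne_top ofReal_ne_top (h v hv u hu huv)⟩
  · intro u v w _ hv _ huv hvw
    exact ne_top_of_le_ne_top (add_ne_top.2 ⟨huv, hvw⟩) (geoDist_triangle hv)

/-- Condition (D) implies that the geodesic diameter of `Ω` is finite. -/
theorem statement_12 {d : ℕ} (Ω : Set (Euc d)) (hΩo : IsOpen Ω) (hΩc : IsConnected Ω)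
    (hΩb : Bornology.IsBounded Ω) (hD : condD Ω) :
    (⨆ x ∈ Ω, ⨆ y ∈ Ω, geoDist Ω x y) ≠ ⊤ := by
  obtain ⟨δ, hδ, h⟩ := hD 1 one_pos
  obtain ⟨t, htΩ, htf, hcov⟩ := totallyBounded_iff_subset.1 (hΩb.isCompact_closure.totallyBounded.subset subset_closure) _
    (Metric.dist_mem_uniformity hδ)
  have hnear : ∀ x ∈ Ω, ∃ p ∈ t, dist x p < δ := fun x hx => by
    simpa using hcov hx
  set M : ℝ≥0∞ := ∑ q ∈ htf.toFinset ×ˢ htf.toFinset, geoDist Ω q.1 q.2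
  have hMtop : M ≠ ⊤ := by
    refine ENNReal.sum_ne_top.2 fun q hq => ?_
    simp only [Finset.mem_product, Finite.mem_toFinset] at hq
    exact geoDist_ne_top hΩc hD (htΩ hq.1) (htΩ hq.2)
  have hloc : ∀ x ∈ Ω, ∀ y ∈ Ω, dist x y < δ → geoDist Ω x y ≤ ENNReal.ofReal (2 * δ) :=
    fun x hx y hy hxy => (h x hx y hy hxy).trans (ENNReal.ofReal_le_ofReal (by linarith))
  refine ne_top_of_le_ne_top (b := ENNReal.ofReal (2 * δ) + (M + ENNReal.ofReal (2 * δ)))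
    (by finiteness) ?_
  refine iSup₂_le fun x hx => iSup₂_le fun y hy => ?_
  obtain ⟨p, hp, hxp⟩ := hnear x hx
  obtain ⟨q, hq, hyq⟩ := hnear y hy
  have hpq : geoDist Ω p q ≤ M :=
    Finset.single_le_sum (f := fun q : Euc d × Euc d => geoDist Ω q.1 q.2)
      (fun _ _ => zero_le) (a := (p, q)) (by simp [hp, hq])
  calc geoDist Ω x y ≤ geoDist Ω x p + geoDist Ω p y := geoDist_triangle (htΩ hp)
    _ ≤ geoDist Ω x p + (geoDist Ω p q + geoDist Ω q y) := by
      gcongr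
      exact geoDist_triangle (htΩ hq)
    _ ≤ _ := by
      gcongr
      · exact hloc x hx p (htΩ hp) hxp
      · exact hloc q (htΩ hq) y hy (by rwa [dist_comm])


end
end

section
/- Let Ω ⊂ ℝ^d be an open bounded domain satisfying the geodesic condition (D), let the kernel η satisfy (K1)–(K3), and let (s_n) ⊂ (0,∞) be a null sequence with r_n/s_n → 0. Then every sequence (u_n) ⊂ L^∞(Ω) with sup_{n∈ℕ} E_{n,cons}(u_n) < ∞ is bounded in the L^∞(Ω) norm. -/
open MeasureTheory Filter Set Topology ENNReal

noncomputable section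

variable {d : ℕ}

/-- Walking along a curve of length at most `N * h` in steps of size `h`, a function whose
oscillation at scale `h` is at most `k` varies by at most `(N + 1) * k`. -/
lemma abs_sub_le_of_eVariationOn_le {E : Type*} [PseudoMetricSpace E] {Ω : Set E} {v : E → ℝ}
    {h k : ℝ} (hh : 0 < h) (hk : 0 ≤ k)
    (hv : ∀ x ∈ Ω, ∀ y ∈ Ω, dist x y ≤ h → |v x - v y| ≤ k) {γ : ℝ → E} {b : ℝ} (N : ℕ) :
    ∀ a ≤ b, ContinuousOn γ (Set.Icc a b) → Set.MapsTo γ (Set.Icc a b) Ω →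
      eVariationOn γ (Set.Icc a b) ≤ ENNReal.ofReal (N * h) →
      |v (γ a) - v (γ b)| ≤ (N + 1) * k := by
  induction N with
  | zero =>
    intro a hab _ hm hvar
    have hd : edist (γ a) (γ b) ≤ ENNReal.ofReal h :=
      (eVariationOn.edist_le γ (left_mem_Icc.2 hab) (right_mem_Icc.2 hab)).trans
        (hvar.trans (by simp))
    have := hv _ (hm (left_mem_Icc.2 hab)) _ (hm (right_mem_Icc.2 hab))
      ((edist_le_ofReal hh.le).1 hd)
    simpa using this
  | succ N ih =>
    intro a hab hc hm hvar
    by_cases hd : dist (γ a) (γ b) ≤ h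
    · have := hv _ (hm (left_mem_Icc.2 hab)) _ (hm (right_mem_Icc.2 hab)) hd
      push_cast
      nlinarith [(Nat.cast_nonneg N : (0 : ℝ) ≤ N)]
    · obtain ⟨t, ht, hdt⟩ : h ∈ (fun t => dist (γ a) (γ t)) '' Set.Icc a b :=
        intermediate_value_Icc hab ((continuous_const.dist continuous_id).comp_continuousOn hc)
          ⟨by simpa using hh.le, (not_le.1 hd).le⟩
      have hsum := eVariationOn.Icc_add_Icc γ (s := Set.univ) ht.1 ht.2 (Set.mem_univ t)
      simp only [Set.univ_inter] at hsum
      have h1 : ENNReal.ofReal h ≤ eVariationOn γ (Set.Icc a t) := by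
        rw [← hdt, ← edist_dist]
        exact eVariationOn.edist_le γ (left_mem_Icc.2 ht.1) (right_mem_Icc.2 ht.1)
      have h2 : eVariationOn γ (Set.Icc t b) ≤ ENNReal.ofReal (N * h) := by
        have h3 : ENNReal.ofReal h + eVariationOn γ (Set.Icc t b)
            ≤ ENNReal.ofReal h + ENNReal.ofReal (N * h) := by
          rw [← ENNReal.ofReal_add hh.le (by positivity)]
          calc _ ≤ eVariationOn γ (Set.Icc a t) + eVariationOn γ (Set.Icc t b) := by gcongr
            _ ≤ _ := by
              rw [hsum]
              refine hvar.trans (le_of_eq ?_)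
              congr 1
              push_cast
              ring
        exact (ENNReal.add_le_add_iff_left ENNReal.ofReal_ne_top).1 h3
      have hsub : Set.Icc t b ⊆ Set.Icc a b := Set.Icc_subset_Icc_left ht.1
      have h4 := ih t ht.2 (hc.mono hsub) (hm.mono_left hsub) h2
      have h5 := hv _ (hm (left_mem_Icc.2 hab)) _ (hm ht) hdt.le
      have h6 := abs_sub_le (v (γ a)) (v (γ t)) (v (γ b))
      push_cast
      linarith

/-- On a totally bounded preconnected set, the total oscillation of a function is controlled by
its oscillation at a fixed scale, with a constant that does not depend on the function. -/
lemma IsPreconnected.exists_forall_abs_sub_le {E : Type*} [PseudoMetricSpace E] {Ω : Set E}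
    (hΩ : IsPreconnected Ω) (hb : TotallyBounded Ω) {δ : ℝ} (hδ : 0 < δ) :
    ∃ m : ℕ, ∀ (v : E → ℝ) (B : ℝ), 0 ≤ B →
      (∀ x ∈ Ω, ∀ y ∈ Ω, dist x y < δ → |v x - v y| ≤ B) →
      ∀ x ∈ Ω, ∀ y ∈ Ω, |v x - v y| ≤ m * B := by
  let P : E → E → Prop := fun x y => ∃ m : ℕ, ∀ (v : E → ℝ) (B : ℝ), 0 ≤ B →
      (∀ x ∈ Ω, ∀ y ∈ Ω, dist x y < δ → |v x - v y| ≤ B) → |v x - v y| ≤ m * B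
  have hP : ∀ x ∈ Ω, ∀ y ∈ Ω, P x y := by
    intro x hx y hy
    refine hΩ.induction₂ P ?_ ?_ ?_ hx hy
    · intro x hx
      filter_upwards [self_mem_nhdsWithin, mem_nhdsWithin_of_mem_nhds (Metric.ball_mem_nhds x hδ)]
        with y hy hyb
      refine ⟨1, fun v B _ hv => ?_⟩
      simpa using hv x hx y hy (by simpa [dist_comm] using hyb)
    · rintro x y z - - - ⟨m, hm⟩ ⟨k, hk⟩
      refine ⟨m + k, fun v B hB hv => ?_⟩
      have h1 := hm v B hB hv
      have h2 := hk v B hB hv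
      have h3 := abs_sub_le (v x) (v y) (v z)
      push_cast
      linarith
    · rintro x y - - ⟨m, hm⟩
      exact ⟨m, fun v B hB hv => abs_sub_comm (v x) (v y) ▸ hm v B hB hv⟩
  rcases Ω.eq_empty_or_nonempty with rfl | ⟨x₀, hx₀⟩
  · exact ⟨0, by simp⟩
  obtain ⟨t, htΩ, htf, ht⟩ := Metric.finite_approx_of_totallyBounded hb δ hδ
  choose! m hm using hP x₀ hx₀
  obtain ⟨M, hM⟩ := (htf.image m).bddAbove
  have key : ∀ (v : E → ℝ) (B : ℝ), 0 ≤ B →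
      (∀ x ∈ Ω, ∀ y ∈ Ω, dist x y < δ → |v x - v y| ≤ B) →
      ∀ x ∈ Ω, |v x₀ - v x| ≤ (M + 1) * B := by
    intro v B hB hv x hx
    obtain ⟨z, hz, hxz⟩ := Set.mem_iUnion₂.1 (ht hx)
    have h1 := hm z (htΩ hz) v B hB hv
    have h2 := hv z (htΩ hz) x hx (by simpa [dist_comm] using hxz)
    have h3 : (m z : ℝ) ≤ M := by exact_mod_cast hM ⟨z, hz, rfl⟩
    have h4 := abs_sub_le (v x₀) (v z) (v x)
    nlinarith
  refine ⟨2 * (M + 1), fun v B hB hv x hx y hy => ?_⟩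
  have h1 := key v B hB hv x hx
  have h2 := key v B hB hv y hy
  have h3 := abs_sub_le (v x) (v x₀) (v y)
  rw [abs_sub_comm] at h1
  push_cast
  linarith

/-- The geodesic distance controls the variation of functions with bounded oscillation at
scale `h`. -/
lemma abs_sub_le_of_geoDist_lt {Ω : Set (Euc d)} {v : Euc d → ℝ} {h k L : ℝ} (hh : 0 < h)
    (hk : 0 ≤ k) (hL : 0 ≤ L) (hv : ∀ x ∈ Ω, ∀ y ∈ Ω, dist x y ≤ h → |v x - v y| ≤ k)
    {x y : Euc d} (hx : x ∈ Ω) (hy : y ∈ Ω) (hxy : geoDist Ω x y < ENNReal.ofReal L) :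
    |v x - v y| ≤ (L / h + 2) * k := by
  simp only [geoDist, iInf_lt_iff] at hxy
  obtain ⟨γ, hc, hm, h0, h1, hvar⟩ := hxy
  have hmaps : Set.MapsTo γ (Set.Icc 0 1) Ω := by
    intro t ht
    rcases ht.1.eq_or_lt with rfl | ht0
    · rwa [h0]
    rcases ht.2.eq_or_lt with rfl | ht1
    · rwa [h1]
    exact hm ⟨ht0, ht1⟩
  have hN : L ≤ ⌈L / h⌉₊ * h := (div_le_iff₀ hh).1 (Nat.le_ceil _)
  have key := abs_sub_le_of_eVariationOn_le hh hk hv ⌈L / h⌉₊ 0 zero_le_one hc hmaps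
    (hvar.le.trans (ENNReal.ofReal_le_ofReal hN))
  rw [h0, h1] at key
  have hN' := Nat.ceil_lt_add_one (div_nonneg hL hh.le)
  nlinarith

lemma dist_le_resol {Ω Ωn : Set (Euc d)} (hΩ : Bornology.IsBounded Ω) (hne : Ωn.Nonempty)
    {pn : Euc d → Euc d} (hpn : IsCPP Ω Ωn pn) {x : Euc d} (hx : x ∈ Ω) :
    dist x (pn x) ≤ resol Ω Ωn := by
  have h1 : dist x (pn x) ≤ Metric.infDist x Ωn :=
    (Metric.le_infDist hne).2 fun _ hy => (hpn x hx).2 _ hy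
  obtain ⟨y, hy⟩ := hne
  obtain ⟨R, hR⟩ := hΩ.subset_closedBall y
  have hbdd : BddAbove (Set.range fun z => ⨆ _ : z ∈ Ω, Metric.infDist z Ωn) := by
    refine ⟨max R 0, ?_⟩
    rintro _ ⟨z, rfl⟩
    exact Real.iSup_le
      (fun hz => le_max_of_le_left ((Metric.infDist_le_dist_of_mem hy).trans (hR hz)))
      (le_max_right _ _)
  refine h1.trans (le_trans ?_ (le_ciSup hbdd x))
  simp [hx]

/-- A bound on the discrete energy bounds differences across edges shorter than `τ * s`. -/
lemma abs_sub_le_of_Edisc_le {Ωn : Set (Euc d)} {η : ℝ → ℝ} {c s τ M : ℝ} (hη : IsKernel η c)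
    (hs : 0 < s) (hτ : 0 < τ) (hητ : 0 < η τ) (hM : 0 ≤ M) {f : Euc d → ℝ}
    (hf : Edisc Ωn η s f ≤ ENNReal.ofReal M) {x y : Euc d} (hx : x ∈ Ωn) (hy : y ∈ Ωn)
    (hxy : dist x y ≤ τ * s) : |f x - f y| ≤ M / η τ * s := by
  have h1 : ENNReal.ofReal (1 / s) * ENNReal.ofReal (η (dist x y / s) * |f x - f y|)
      ≤ ENNReal.ofReal M := by
    refine le_trans ?_ hf
    unfold Edisc
    gcongr
    exact le_iSup₂_of_le x hx (le_iSup₂_of_le y hy le_rfl)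
  rw [← ENNReal.ofReal_mul (by positivity), ENNReal.ofReal_le_ofReal_iff hM] at h1
  have h2 : η τ ≤ η (dist x y / s) :=
    hη.antitone (by simp only [Set.mem_Ici]; positivity) (Set.mem_Ici.2 hτ.le)
      ((div_le_iff₀ hs).2 hxy)
  rw [div_mul_eq_mul_div, one_mul, div_le_iff₀ hs] at h1
  rw [div_mul_eq_mul_div, le_div_iff₀ hητ]
  nlinarith [abs_nonneg (f x - f y)]

lemma einfNorm_le_of_forall_abs_le {Ω : Set (Euc d)} (hΩ : MeasurableSet Ω) {u v : Euc d → ℝ}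
    (huv : u =ᵐ[volume.restrict Ω] v) {C : ℝ} (hC : ∀ x ∈ Ω, |v x| ≤ C) :
    einfNorm Ω u ≤ ENNReal.ofReal C := by
  refine essSup_le_of_ae_le _ ?_
  filter_upwards [huv, ae_restrict_mem hΩ] with x hx hxΩ
  change ‖u x‖ₑ ≤ _
  rw [hx, Real.enorm_eq_ofReal_abs]
  exact ENNReal.ofReal_le_ofReal (hC x hxΩ)

lemma iSup_ne_top_of_eventually_le {a : ℕ → ℝ≥0∞} (ha : ∀ n, a n ≠ ⊤) {C : ℝ≥0∞} (hC : C ≠ ⊤)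
    (h : ∀ᶠ n in atTop, a n ≤ C) : (⨆ n, a n) ≠ ⊤ := by
  obtain ⟨N, hN⟩ := eventually_atTop.1 h
  have hsum : (∑ n ∈ Finset.range N, a n) + C ≠ ⊤ :=
    ENNReal.add_ne_top.2 ⟨ENNReal.sum_ne_top.2 fun n _ => ha n, hC⟩
  refine ne_top_of_le_ne_top hsum (iSup_le fun n => ?_)
  rcases lt_or_ge n N with hn | hn
  · exact (Finset.single_le_sum (fun _ _ => zero_le) (Finset.mem_range.2 hn)).trans
      le_self_add
  · exact (hN n hn).trans le_add_self

/-- Sequences with uniformly bounded constrained discrete energies are bounded in `L^∞(Ω)`. -/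
theorem statement_13 {d : ℕ} (Ω : Set (Euc d)) (hΩo : IsOpen Ω) (hΩc : IsConnected Ω)
    (hΩb : Bornology.IsBounded Ω) (hD : condD Ω)
    (η : ℝ → ℝ) (c : ℝ) (hη : IsKernel η c)
    (g : Euc d → ℝ) (Kg : NNReal) (hg : LipschitzOnWith Kg g (closure Ω))
    (Ωn : ℕ → Set (Euc d)) (hfin : ∀ n, (Ωn n).Finite) (hne : ∀ n, (Ωn n).Nonempty)
    (hsub : ∀ n, Ωn n ⊆ closure Ω)
    (pn : ℕ → Euc d → Euc d) (hpn : ∀ n, IsCPP Ω (Ωn n) (pn n))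
    (On : ℕ → Set (Euc d)) (hOnsub : ∀ n, On n ⊆ Ωn n) (hOnne : ∀ n, (On n).Nonempty)
    (O : Set (Euc d)) (hO : IsClosed O) (hOsub : O ⊆ closure Ω) (hOne : O.Nonempty)
    (s : ℕ → ℝ) (hs : ∀ n, 0 < s n) (hs0 : Filter.Tendsto s Filter.atTop (nhds 0))
    (hscale : Filter.Tendsto (fun n => resol Ω (Ωn n) / s n) Filter.atTop (nhds 0))
    (hH : Filter.Tendsto (fun n => Metric.hausdorffDist (On n) O / s n) Filter.atTop (nhds 0))
    (un : ℕ → Euc d → ℝ)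
    (hE : (⨆ n, EdiscCons Ω (Ωn n) (On n) (pn n) g η (s n) (un n)) ≠ ⊤) :
    (⨆ n, einfNorm Ω (un n)) ≠ ⊤ := by
  obtain ⟨τ, hτ, hητ⟩ : ∃ τ, 0 < τ ∧ 0 < η τ := by
    obtain ⟨ε, hε, hε'⟩ := Metric.eventually_nhds_iff.1
      (hη.cont_zero.eventually (lt_mem_nhds hη.pos_zero))
    exact ⟨ε / 2, half_pos hε, hε' (by simp [abs_of_pos hε, hε])⟩
  obtain ⟨δ, hδ, hgeo⟩ := hD 1 one_pos
  obtain ⟨m, hm⟩ := hΩc.isPreconnected.exists_forall_abs_sub_le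
    (hΩb.isCompact_closure.totallyBounded.subset subset_closure) hδ
  obtain ⟨G, hG⟩ := hΩb.isCompact_closure.exists_bound_of_continuousOn hg.continuousOn
  set M : ℝ := (⨆ n, EdiscCons Ω (Ωn n) (On n) (pn n) g η (s n) (un n)).toReal + 1 with hMdef
  have hM : 0 ≤ M := by positivity
  have hf : ∀ n, ∃ f : Euc d → ℝ, (un n =ᵐ[volume.restrict Ω] fun x => f (pn n x)) ∧
      Set.EqOn f g (On n) ∧ Edisc (Ωn n) η (s n) f ≤ ENNReal.ofReal M := by
    intro n
    have hlt : EdiscCons Ω (Ωn n) (On n) (pn n) g η (s n) (un n) < ENNReal.ofReal M := by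
      refine (le_iSup (fun n => EdiscCons Ω (Ωn n) (On n) (pn n) g η (s n) (un n)) n).trans_lt ?_
      rw [ENNReal.lt_ofReal_iff_toReal_lt hE]
      exact lt_add_one _
    simp only [EdiscCons, iInf_lt_iff] at hlt
    obtain ⟨f, hfu, hfg, hlt⟩ := hlt
    exact ⟨f, hfu, hfg, hlt.le⟩
  choose f hfu hfg hfE using hf
  set K : ℝ := M / η τ with hKdef
  have hK : 0 ≤ K := by positivity
  set L : ℝ := 2 * δ + 1 with hLdef
  have hL : 0 < L := by positivity
  set B : ℝ := (L / (τ / 2) + 2) * K with hBdef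
  have hB : 0 ≤ B := by positivity
  refine iSup_ne_top_of_eventually_le (C := ENNReal.ofReal (m * B + K + G)) ?_
    ENNReal.ofReal_ne_top ?_
  · intro n
    obtain ⟨C, hC⟩ := ((hfin n).image fun x => |f n x|).bddAbove
    exact ne_top_of_le_ne_top ENNReal.ofReal_ne_top (einfNorm_le_of_forall_abs_le
      hΩo.measurableSet (hfu n) fun x hx => hC ⟨_, (hpn n x hx).1, rfl⟩)
  filter_upwards [hs0.eventually (gt_mem_nhds one_pos),
    hscale.eventually (gt_mem_nhds (by positivity : 0 < τ / 4))] with n hsn hrn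
  have hsp := hs n
  rw [div_lt_iff₀ hsp] at hrn
  refine einfNorm_le_of_forall_abs_le hΩo.measurableSet (hfu n) fun x hx => ?_
  have hedge : ∀ y ∈ Ωn n, ∀ z ∈ Ωn n, dist y z ≤ τ * s n → |f n y - f n z| ≤ K * s n :=
    fun y hy z hz => abs_sub_le_of_Edisc_le hη hsp hτ hητ hM (hfE n) hy hz
  have hr : ∀ y ∈ Ω, dist y (pn n y) ≤ τ / 4 * s n := fun y hy =>
    (dist_le_resol hΩb (hne n) (hpn n) hy).trans hrn.le
  have hstep : ∀ y ∈ Ω, ∀ z ∈ Ω, dist y z ≤ τ / 2 * s n →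
      |f n (pn n y) - f n (pn n z)| ≤ K * s n := by
    intro y hy z hz hyz
    refine hedge _ (hpn n y hy).1 _ (hpn n z hz).1 ?_
    have h1 := dist_triangle4 (pn n y) y z (pn n z)
    have h2 := hr y hy
    have h3 := hr z hz
    rw [dist_comm] at h2
    linarith
  have hosc : ∀ y ∈ Ω, ∀ z ∈ Ω, dist y z < δ → |f n (pn n y) - f n (pn n z)| ≤ B := by
    intro y hy z hz hyz
    have h1 : geoDist Ω y z < ENNReal.ofReal L :=
      (hgeo y hy z hz hyz).trans_lt ((ENNReal.ofReal_lt_ofReal_iff hL).2 (by linarith))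
    have h2 := abs_sub_le_of_geoDist_lt (v := fun x => f n (pn n x))
      (by positivity : 0 < τ / 2 * s n) (by positivity) hL.le hstep hy hz h1
    refine h2.trans ?_
    have h3 : (L / (τ / 2 * s n) + 2) * (K * s n) = (L / (τ / 2) + 2 * s n) * K := by
      field_simp
    rw [h3, hBdef]
    gcongr
    linarith
  obtain ⟨o, ho⟩ := hOnne n
  have hoc := hsub n (hOnsub n ho)
  obtain ⟨z, hz, hoz⟩ := Metric.mem_closure_iff.1 hoc (τ / 4 * s n) (by positivity)
  have h1 := hm (fun x => f n (pn n x)) B hB hosc x hx z hz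
  have h2 : |f n (pn n z) - f n o| ≤ K * s n := by
    refine hedge _ (hpn n z hz).1 _ (hOnsub n ho) ?_
    have h3 := dist_triangle (pn n z) z o
    have h4 := hr z hz
    rw [dist_comm] at h4 hoz
    have h5 : 0 < τ * s n := by positivity
    linarith
  have h3 : |f n o| ≤ G := by
    rw [hfg n ho]
    exact hG o hoc
  have h4 : K * s n ≤ K := mul_le_of_le_one_right hK hsn.le
  calc |f n (pn n x)|
      = |(f n (pn n x) - f n (pn n z)) + (f n (pn n z) - f n o) + f n o| := by ring_nf
    _ ≤ |f n (pn n x) - f n (pn n z)| + |f n (pn n z) - f n o| + |f n o| := abs_add_three _ _ _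
    _ ≤ m * B + K + G := by linarith


end
end
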